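/- For all integers n ≥ 2 and m > 4n, there exists a non-homotopic drawing in the plane with n vertices and m edges whose crossing number is at most 30·(m²/n)·(log₂(m/n))². -/

import Mathlib

open unitInterval ENNReal

/-- A drawing in the plane with `n` vertices and `m` edges: a finite set `V ⊆ ℂ` of
`n` vertices together with continuous curves `f e : [0,1] → ℂ` whose endpoints are
vertices and whose interiors avoid the vertices. -/
structure PlaneDrawing (n m : ℕ) where
  V : Set ℂ
  finV : V.Finite
  cardV : V.ncard = n
  f : Fin m → I → ℂ
  cont : ∀ e, Continuous (f e)
  source_mem : ∀ e, f e 0 ∈ V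
  target_mem : ∀ e, f e 1 ∈ V
  interior_not_mem : ∀ e, ∀ t : I, t ≠ 0 → t ≠ 1 → f e t ∉ V

/-- Homotopy between two curves, fixing the endpoints of the first, with interior
avoiding the vertex set `V`. -/
def HomotopicIn (V : Set ℂ) (a b : I → ℂ) : Prop :=
  ∃ g : I × I → ℂ, Continuous g ∧
    (∀ t, g (0, t) = a t) ∧ (∀ t, g (1, t) = b t) ∧
    (∀ s, g (s, 0) = a 0) ∧ (∀ s, g (s, 1) = a 1) ∧
    (∀ s t : I, s ≠ 0 → s ≠ 1 → t ≠ 0 → t ≠ 1 → g (s, t) ∉ V)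

/-- Two edges are homotopic if one is homotopic to the other or to its reversal. -/
def EdgeHomotopic (V : Set ℂ) (a b : I → ℂ) : Prop :=
  HomotopicIn V a b ∨ HomotopicIn V (fun t => a (σ t)) b

/-- An edge is a trivial loop if it is homotopic to the constant map at its endpoint. -/
def IsTrivialLoop (V : Set ℂ) (a : I → ℂ) : Prop :=
  EdgeHomotopic V a fun _ => a 0

/-- A drawing is non-homotopic if no two distinct edges are homotopic and
no edge is a trivial loop. -/
def PlaneDrawing.NonHomotopic {n m : ℕ} (D : PlaneDrawing n m) : Prop :=
  (∀ e e' : Fin m, e ≠ e' → ¬ EdgeHomotopic D.V (D.f e) (D.f e')) ∧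
  (∀ e : Fin m, ¬ IsTrivialLoop D.V (D.f e))

/-- The crossing number: half the cardinality of the set of ordered crossings. -/
noncomputable def PlaneDrawing.crossingNumber {n m : ℕ} (D : PlaneDrawing n m) : ℝ≥0∞ :=
  (({p : (Fin m × I) × (Fin m × I) |
      p.1 ≠ p.2 ∧ p.1.2 ≠ 0 ∧ p.1.2 ≠ 1 ∧ p.2.2 ≠ 0 ∧ p.2.2 ≠ 1 ∧
      D.f p.1.1 p.1.2 = D.f p.2.1 p.2.2}).encard : ℝ≥0∞) / 2

/-- The three components of `ℝ \ {0, 1}`. -/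
def realGap : Fin 3 → Set ℝ := ![Set.Iio 0, Set.Ioo 0 1, Set.Ioi 1]

lemma isOpen_realGap (w : Fin 3) : IsOpen (realGap w) := by
  fin_cases w
  · exact isOpen_Iio
  · exact isOpen_Ioo
  · exact isOpen_Ioi

lemma realGap_disjoint {i j : Fin 3} {x : ℝ} (hi : x ∈ realGap i) (hj : x ∈ realGap j) :
    i = j := by
  fin_cases i <;> fin_cases j <;> simp [realGap] at hi hj ⊢ <;> linarith

lemma exists_mem_realGap {x : ℝ} (h0 : x ≠ 0) (h1 : x ≠ 1) : ∃ w, x ∈ realGap w := by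
  rcases lt_or_gt_of_ne h0 with h | h
  · exact ⟨0, h⟩
  · rcases lt_or_gt_of_ne h1 with h' | h'
    · exact ⟨1, h, h'⟩
    · exact ⟨2, h'⟩

/-- The union of the open upper and lower half-planes and one component of `ℝ \ {0, 1}`. -/
def slitChart (w : Fin 3) : Set ℂ := {z | z.im ≠ 0 ∨ z.re ∈ realGap w}

lemma isOpen_slitChart (w : Fin 3) : IsOpen (slitChart w) :=
  (isOpen_ne_fun Complex.continuous_im continuous_const).union
    ((isOpen_realGap w).preimage Complex.continuous_re)

lemma exists_mem_slitChart {z : ℂ} (h0 : z ≠ 0) (h1 : z ≠ 1) : ∃ w, z ∈ slitChart w := by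
  by_cases h : z.im = 0
  · obtain ⟨w, hw⟩ := exists_mem_realGap (x := z.re)
      (fun h' => h0 (Complex.ext h' h)) (fun h' => h1 (Complex.ext h' h))
    exact ⟨w, Or.inr hw⟩
  · exact ⟨0, Or.inl h⟩

/-- The plane punctured at `0` and `1`. -/
abbrev TwicePunctured := {z : ℂ // z ≠ 0 ∧ z ≠ 1}

section Covering

variable {F : Type*} (τ : Fin 3 → F → F)

open Classical in
/-- The change between the coordinate of the chart `slitChart w` and the coordinate that is
adapted to each of the two half-planes. -/
noncomputable def halfTwist (w : Fin 3) (z : ℂ) (v : F) : F := if z.im < 0 then τ w v else v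

variable {τ}

lemma halfTwist_halfTwist (hτ : ∀ w, Function.Involutive (τ w)) (w : Fin 3) (z : ℂ) (v : F) :
    halfTwist τ w z (halfTwist τ w z v) = v := by
  unfold halfTwist
  split_ifs
  · exact hτ w v
  · rfl

lemma halfTwist_of_invariant {Y : Type*} {ρ : F → Y} {w : Fin 3} (h : ∀ v, ρ (τ w v) = ρ v)
    (z : ℂ) (v : F) : ρ (halfTwist τ w z v) = ρ v := by
  unfold halfTwist
  split_ifs
  · exact h v
  · rfl

lemma halfTwist_eventuallyEq {z : ℂ} (hz : z.im ≠ 0) (w : Fin 3) :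
    ∀ᶠ z' in nhds z, halfTwist τ w z' = halfTwist τ w z := by
  rcases lt_or_gt_of_ne hz with h | h
  · filter_upwards [(isOpen_lt Complex.continuous_im continuous_const).mem_nhds h] with z' hz'
    have hz'' : z'.im < 0 := hz'
    funext v
    simp [halfTwist, h, hz'']
  · filter_upwards [(isOpen_lt continuous_const Complex.continuous_im).mem_nhds h] with z' hz'
    have hz'' : 0 < z'.im := hz'
    funext v
    simp [halfTwist, h.not_gt, hz''.not_gt]

/-- The covering of the twice punctured plane in which crossing the component `w` of
`ℝ \ {0, 1}` acts on the fibre by the involution `τ w`. -/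
noncomputable def crossingCore [TopologicalSpace F] [DiscreteTopology F]
    (hτ : ∀ w, Function.Involutive (τ w)) : FiberBundleCore (Fin 3) TwicePunctured F where
  baseSet w := {z | (z : ℂ) ∈ slitChart w}
  isOpen_baseSet w := (isOpen_slitChart w).preimage continuous_subtype_val
  indexAt z := (exists_mem_slitChart z.2.1 z.2.2).choose
  mem_baseSet_at z := (exists_mem_slitChart z.2.1 z.2.2).choose_spec
  coordChange i j z v := halfTwist τ j z (halfTwist τ i z v)
  coordChange_self i z _ v := halfTwist_halfTwist hτ i z v
  continuousOn_coordChange i j := by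
    rcases eq_or_ne i j with rfl | hij
    · simp only [halfTwist_halfTwist hτ]
      exact continuous_snd.continuousOn
    · rintro ⟨z, v⟩ ⟨⟨hi, hj⟩, -⟩
      have hz : (z : ℂ).im ≠ 0 := by
        by_contra h0
        exact hij (realGap_disjoint (hi.resolve_left (not_not.2 h0))
          (hj.resolve_left (not_not.2 h0)))
      have h1 := (halfTwist_eventuallyEq (τ := τ) hz i).and (halfTwist_eventuallyEq (τ := τ) hz j)
      refine (ContinuousAt.congr (f := fun _ : TwicePunctured × F =>
        halfTwist τ j z (halfTwist τ i z v)) continuousAt_const ?_).continuousWithinAt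
      have h2 : ∀ᶠ p : TwicePunctured × F in nhds (z, v), p.2 = v :=
        (continuous_snd.tendsto (z, v)).eventually (p := fun x => x = v) (by simp [nhds_discrete])
      have h3 := ((continuous_subtype_val.comp continuous_fst).tendsto
        ((z, v) : TwicePunctured × F)).eventually h1
      filter_upwards [h2, h3] with p hp hp'
      simp only [Function.comp] at hp'
      rw [hp, hp'.1, hp'.2]
  coordChange_comp i j k z _ v := by
    rw [halfTwist_halfTwist hτ j]

/-- A map from the unit square to the twice punctured plane carries a function to the
fibre `F` that stays constant in each half-plane and changes by `τ w` across the component `w` of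
`ℝ \ {0, 1}`. -/
theorem exists_sheet_function (hτ : ∀ w, Function.Involutive (τ w))
    {H : I × I → ℂ} (hH : Continuous H) (h0 : ∀ a, H a ≠ 0) (h1 : ∀ a, H a ≠ 1) (v₀ : F) :
    ∃ h : I × I → F, h (0, 0) = v₀ ∧
      (∀ w, ∀ T : Set (I × I), IsPreconnected T → (∀ x ∈ T, H x ∈ slitChart w) →
        ∀ x ∈ T, ∀ y ∈ T, halfTwist τ w (H x) (h x) = halfTwist τ w (H y) (h y)) ∧
      (∀ (Y : Type) (ρ : F → Y), ∀ T : Set (I × I), IsPreconnected T →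
        (∀ x ∈ T, ∃ w, H x ∈ slitChart w ∧ ∀ v, ρ (τ w v) = ρ v) →
        ∀ x ∈ T, ∀ y ∈ T, ρ (h x) = ρ (h y)) := by
  let _ : TopologicalSpace F := ⊥
  have : DiscreteTopology F := ⟨rfl⟩
  let Z := crossingCore hτ
  have cov : IsCoveringMap Z.proj := FiberBundle.isCoveringMap
  let f : C(I × I, TwicePunctured) := ⟨fun a => ⟨H a, h0 a, h1 a⟩, hH.subtype_mk _⟩
  let e₀ : Z.TotalSpace := ⟨f (0, 0), halfTwist τ (Z.indexAt (f (0, 0))) (H (0, 0)) v₀⟩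
  obtain ⟨G, hG0, hG⟩ : ∃ G : C(I × I, Z.TotalSpace), G (0, 0) = e₀ ∧ Z.proj ∘ G = f := by
    let γ : C(I, TwicePunctured) := ⟨fun t => f (0, t), by fun_prop⟩
    obtain ⟨Γ, hΓ, hΓ0⟩ := cov.exists_path_lifts γ e₀ rfl
    exact ⟨cov.liftHomotopy f Γ fun a => (congrFun hΓ a).symm,
      (cov.liftHomotopy_zero ..).trans hΓ0, cov.liftHomotopy_lifts ..⟩
  have hGa : ∀ a, (G a).1 = f a := fun a => congrFun hG a
  let coord : Fin 3 → I × I → F := fun w a => (Z.localTriv w (G a)).2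
  let h : I × I → F := fun a => halfTwist τ (Z.indexAt (f a)) (H a) (G a).2
  have hval : ∀ w a, coord w a = halfTwist τ w (H a) (h a) := by
    intro w a
    change halfTwist τ w ((G a).1 : ℂ) (halfTwist τ (Z.indexAt (G a).1) ((G a).1 : ℂ) (G a).2) = _
    rw [hGa]
    rfl
  have hcont : ∀ w a, H a ∈ slitChart w → ContinuousAt (coord w) a := by
    intro w a ha
    have h2 : G a ∈ (Z.localTriv w).source := by
      rw [Z.mem_localTriv_source, ← Z.baseSet_at, hGa]
      exact ha
    exact continuous_snd.continuousAt.comp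
      (((Z.localTriv w).continuousAt h2).comp G.continuous.continuousAt)
  refine ⟨h, ?_, ?_, ?_⟩
  · have : ((G (0, 0)).2 : F) = halfTwist τ (Z.indexAt (f (0, 0))) (H (0, 0)) v₀ := by rw [hG0]; rfl
    change halfTwist τ (Z.indexAt (f (0, 0))) (H (0, 0)) (G (0, 0)).2 = v₀
    rw [this, halfTwist_halfTwist hτ]
  · intro w T hT hTw x hx y hy
    rw [← hval, ← hval]
    exact hT.constant (fun a ha => (hcont w a (hTw a ha)).continuousWithinAt) hx hy
  · intro Y ρ T hT hTw x hx y hy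
    let _ : TopologicalSpace Y := ⊥
    have : DiscreteTopology Y := ⟨rfl⟩
    refine hT.constant (f := fun a => ρ (h a)) (fun a ha => ?_) hx hy
    obtain ⟨w, hw, hρ⟩ := hTw a ha
    have : (fun a => ρ (h a)) = fun a => ρ (coord w a) := by
      funext b
      rw [hval, halfTwist_of_invariant hρ]
    rw [this]
    exact ((continuous_of_discreteTopology (f := ρ)).continuousAt.comp
      (hcont w a hw)).continuousWithinAt

end Covering

section Tracking

variable {F : Type*} (τ : Fin 3 → F → F)

/-- `Traces τ γ t₀ v₀ t v` says that the curve `γ` runs in the upper half-plane up to the time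
`t₀`, and between the times `t₀` and `t` it crosses components `w` of `ℝ \ {0, 1}` one after
the other, the corresponding maps `τ w` taking `v₀` to `v`. -/
inductive Traces (γ : I → ℂ) (t₀ : I) (v₀ : F) : I → F → Prop
  | start : (∀ u, 0 < u → u ≤ t₀ → 0 < (γ u).im) → Traces γ t₀ v₀ t₀ v₀
  | cross (t t' : I) (w : Fin 3) (v : F) : Traces γ t₀ v₀ t v → t ≤ t' →
      (∀ u ∈ Set.Icc t t', γ u ∈ slitChart w) → (γ t).im * (γ t').im < 0 →
      Traces γ t₀ v₀ t' (τ w v)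

variable {τ}

lemma Traces.le {γ : I → ℂ} {t₀ t : I} {v₀ v : F} (h : Traces τ γ t₀ v₀ t v) : t₀ ≤ t := by
  induction h with
  | start => exact le_rfl
  | cross t t' w v _ h1 _ _ ih => exact ih.trans h1

lemma halfTwist_of_pos {w : Fin 3} {z : ℂ} (hz : 0 < z.im) (v : F) : halfTwist τ w z v = v :=
  if_neg hz.not_gt

lemma halfTwist_of_neg {w : Fin 3} {z : ℂ} (hz : z.im < 0) (v : F) :
    halfTwist τ w z v = τ w v :=
  if_pos hz

lemma exists_mem_slitChart_near_zero {z : ℂ} (h0 : z ≠ 0) (hz : ‖z‖ < 1) :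
    ∃ w, z ∈ slitChart w ∧ (w = 0 ∨ w = 1) := by
  obtain ⟨w, hw⟩ := exists_mem_slitChart h0 (fun h => by simp [h] at hz)
  by_cases hi : z.im = 0
  · refine ⟨w, hw, ?_⟩
    have h1 := (Complex.re_le_norm z).trans_lt hz
    have h2 := hw.resolve_left (not_not.2 hi)
    fin_cases w <;> simp [realGap] at h2 ⊢
    linarith
  · exact ⟨0, Or.inl hi, Or.inl rfl⟩

lemma exists_mem_slitChart_near_one {z : ℂ} (h1 : z ≠ 1) (hz : ‖z - 1‖ < 1) :
    ∃ w, z ∈ slitChart w ∧ (w = 1 ∨ w = 2) := by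
  obtain ⟨w, hw⟩ := exists_mem_slitChart (fun h => by simp [h] at hz) h1
  by_cases hi : z.im = 0
  · refine ⟨w, hw, ?_⟩
    have h1 := abs_lt.1 ((Complex.abs_re_le_norm (z - 1)).trans_lt hz)
    have h2 := hw.resolve_left (not_not.2 hi)
    simp at h1
    fin_cases w <;> simp [realGap] at h2 ⊢
    linarith
  · exact ⟨1, Or.inl hi, Or.inl rfl⟩

lemma exists_uniform_near_endpoints {g : I × I → ℂ} (hg : Continuous g) {p q : ℂ}
    (h0 : ∀ s, g (s, 0) = p) (h1 : ∀ s, g (s, 1) = q) :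
    ∃ δ : ℝ, 0 < δ ∧ (∀ s t : I, (t : ℝ) ≤ δ → ‖g (s, t) - p‖ < 1) ∧
      (∀ s t : I, 1 - δ ≤ (t : ℝ) → ‖g (s, t) - q‖ < 1) := by
  have huc := Metric.uniformContinuous_iff.1
    (CompactSpace.uniformContinuous_of_continuous hg) 1 one_pos
  obtain ⟨δ, hδ, H⟩ := huc
  refine ⟨δ / 2, by positivity, fun s t ht => ?_, fun s t ht => ?_⟩
  · rw [← h0 s, ← dist_eq_norm]
    apply H
    rw [Prod.dist_eq, dist_self, Subtype.dist_eq, Real.dist_eq, max_lt_iff, abs_lt]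
    have := t.2.1
    exact ⟨hδ, by simp; linarith, by simp; linarith⟩
  · rw [← h1 s, ← dist_eq_norm]
    apply H
    rw [Prod.dist_eq, dist_self, Subtype.dist_eq, Real.dist_eq, max_lt_iff, abs_lt]
    have := t.2.2
    exact ⟨hδ, by simp; linarith, by simp; linarith⟩

/-- Homotopic curves from `0` to `1` in the twice punctured plane end on sheets which agree up
to crossings of the components of `ℝ \ {0, 1}` adjacent to `1`. -/
theorem HomotopicIn.eq_of_traces (hτ : ∀ w, Function.Involutive (τ w)) {v₀ v v' : F}
    (hv0 : τ 0 v₀ = v₀) (hv1 : τ 1 v₀ = v₀) {Y : Type} {ρ : F → Y}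
    (hρ1 : ∀ v, ρ (τ 1 v) = ρ v) (hρ2 : ∀ v, ρ (τ 2 v) = ρ v)
    {a b : I → ℂ} (hab : HomotopicIn {0, 1} a b) (ha0 : a 0 = 0) (ha1 : a 1 = 1)
    (ha : ∀ t : I, t ≠ 0 → t ≠ 1 → a t ∉ ({0, 1} : Set ℂ))
    (hb : ∀ t : I, t ≠ 0 → t ≠ 1 → b t ∉ ({0, 1} : Set ℂ))
    {t₀ t t₀' t' : I} (ht₀ : 0 < t₀) (ht : t < 1) (ht₀' : 0 < t₀') (ht' : t' < 1)
    (hta : Traces τ a t₀ v₀ t v) (htb : Traces τ b t₀' v₀ t' v')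
    (hea : ∀ u, t ≤ u → u < 1 → 0 < (a t).im * (a u).im)
    (heb : ∀ u, t' ≤ u → u < 1 → 0 < (b t').im * (b u).im) : ρ v = ρ v' := by
  obtain ⟨g, hg, hga, hgb, hg0, hg1, hgV⟩ := hab
  rw [ha0] at hg0
  rw [ha1] at hg1
  have hV : ∀ s t : I, t ≠ 0 → t ≠ 1 → g (s, t) ∉ ({0, 1} : Set ℂ) := by
    intro s t h0 h1
    by_cases hs0 : s = 0
    · rw [hs0, hga]; exact ha t h0 h1
    by_cases hs1 : s = 1
    · rw [hs1, hgb]; exact hb t h0 h1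
    exact hgV s t hs0 hs1 h0 h1
  obtain ⟨δ, hδ, hδ0, hδ1⟩ := exists_uniform_near_endpoints hg hg0 hg1
  have hpos : ∀ {x : I}, 0 < x → (0 : ℝ) < x := fun h => h
  have hlt : ∀ {x : I}, x < 1 → (x : ℝ) < 1 := fun h => h
  obtain ⟨ε, hε, hεδ, hε2, hεt₀, hεt₀', hεt, hεt'⟩ : ∃ ε : ℝ, 0 < ε ∧ ε ≤ δ ∧ ε < 1 / 2 ∧
      ε ≤ t₀ ∧ ε ≤ t₀' ∧ t ≤ 1 - ε ∧ t' ≤ 1 - ε := by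
    obtain ⟨ε, hε⟩ : ∃ ε : ℝ,
      ε = min δ (min (1 / 3) (min (min (t₀ : ℝ) t₀') (min (1 - t : ℝ) (1 - t')))) := ⟨_, rfl⟩
    have hle := hε.le
    have hε0 : 0 < ε := by
      rw [hε]
      simp only [lt_min_iff]
      exact ⟨hδ, by norm_num, ⟨hpos ht₀, hpos ht₀'⟩, sub_pos.2 (hlt ht), sub_pos.2 (hlt ht')⟩
    simp only [le_min_iff] at hle
    obtain ⟨h1, h2, ⟨h3, h4⟩, h5, h6⟩ := hle
    exact ⟨ε, hε0, h1, by linarith, h3, h4, by linarith, by linarith⟩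
  let lo : I := ⟨ε, by constructor <;> linarith⟩
  let hi : I := ⟨1 - ε, by constructor <;> linarith⟩
  have hlohi : lo ≤ hi := by change ε ≤ 1 - ε; linarith
  let φ : I → I := fun u => max lo (min u hi)
  have hφ : Continuous φ := by fun_prop
  have hφ_id : ∀ u, lo ≤ u → u ≤ hi → φ u = u := by
    intro u h1 h2
    simp [φ, h1, h2]
  have hφlo : ∀ u, lo ≤ φ u := fun u => le_max_left _ _
  have hφhi : ∀ u, φ u ≤ hi := fun u => max_le hlohi (min_le_right _ _)
  have hφmono : Monotone φ := fun x y h => max_le_max le_rfl (min_le_min h le_rfl)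
  have hlo0 : 0 < lo := hε
  have hhi1 : hi < 1 := by change 1 - ε < (1 : ℝ); linarith
  have hφ0 : φ 0 = lo := by simp [φ]
  have hφ1 : φ 1 = hi := by
    change max lo (min 1 hi) = hi
    rw [min_eq_right hhi1.le, max_eq_right hlohi]
  have hφn0 : ∀ u, φ u ≠ 0 := fun u => (hlo0.trans_le (hφlo u)).ne'
  have hφn1 : ∀ u, φ u ≠ 1 := fun u => ((hφhi u).trans_lt hhi1).ne
  obtain ⟨h, hh0, hchart, hinv⟩ := exists_sheet_function (τ := τ) hτ
    (H := fun x => g (x.1, φ x.2)) (by fun_prop)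
    (fun x hx => hV x.1 (φ x.2) (hφn0 _) (hφn1 _) (Or.inl hx))
    (fun x hx => hV x.1 (φ x.2) (hφn0 _) (hφn1 _) (Or.inr hx)) v₀
  have hstart : ∀ s, h (s, 0) = v₀ := by
    intro s
    have key := hinv Prop (fun v => v = v₀) (Set.univ ×ˢ {0})
      (isPreconnected_univ.prod isPreconnected_singleton) (by
        rintro ⟨s, u⟩ ⟨-, rfl : u = 0⟩
        have hs : ‖g (s, φ 0)‖ < 1 := by
          simpa using hδ0 s (φ 0) (by rw [hφ0]; exact hεδ)
        obtain ⟨w, hw, hw'⟩ := exists_mem_slitChart_near_zero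
          (fun h => hV s (φ 0) (hφn0 _) (hφn1 _) (Or.inl h)) hs
        refine ⟨w, hw, fun v => propext ?_⟩
        have hw0 : τ w v₀ = v₀ := by rcases hw' with rfl | rfl <;> assumption
        rw [(hτ w).eq_iff, hw0]) (0, 0) ⟨trivial, rfl⟩ (s, 0) ⟨trivial, rfl⟩
    simpa [hh0] using key
  have hend : ρ (h (0, 1)) = ρ (h (1, 1)) := by
    refine hinv Y ρ (Set.univ ×ˢ {1}) (isPreconnected_univ.prod isPreconnected_singleton) ?_
      (0, 1) ⟨trivial, rfl⟩ (1, 1) ⟨trivial, rfl⟩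
    rintro ⟨s, u⟩ ⟨-, rfl : u = 1⟩
    have hs : ‖g (s, φ 1) - 1‖ < 1 :=
      hδ1 s (φ 1) (by rw [hφ1]; change 1 - δ ≤ 1 - ε; linarith)
    obtain ⟨w, hw, hw'⟩ := exists_mem_slitChart_near_one
      (fun h => hV s (φ 1) (hφn0 _) (hφn1 _) (Or.inr h)) hs
    refine ⟨w, hw, ?_⟩
    rcases hw' with rfl | rfl <;> assumption
  have track : ∀ (s : I) (c : I → ℂ), (∀ u, g (s, u) = c u) → ∀ (t₀ t : I) (v : F),
      lo ≤ t₀ → t ≤ hi → Traces τ c t₀ v₀ t v → (∀ u, t ≤ u → u < 1 → 0 < (c t).im * (c u).im) →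
      h (s, 1) = v := by
    intro s c hc t₀ t v hlo hhi htr hfin
    have hseg : ∀ x y : I, IsPreconnected (({s} : Set I) ×ˢ Set.Icc x y) := fun x y =>
      isPreconnected_singleton.prod isPreconnected_Icc
    have main : ∀ t v, Traces τ c t₀ v₀ t v → t ≤ hi → h (s, t) = v ∧ (c t).im ≠ 0 := by
      intro t v htr
      induction htr with
      | start hup =>
        intro hhi
        have hup' : ∀ u, u ≤ t₀ → 0 < (c (φ u)).im := fun u hu =>
          hup _ (hlo0.trans_le (hφlo u)) ((hφmono hu).trans_eq (hφ_id _ hlo hhi))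
        have key := hchart 0 _ (hseg 0 t₀) (by
          rintro ⟨s', u⟩ ⟨rfl : s' = s, hu⟩
          exact Or.inl (by simpa [hc] using (hup' u hu.2).ne')) (s, 0) ⟨rfl, le_rfl, t₀.2.1⟩
            (s, t₀) ⟨rfl, t₀.2.1, le_rfl⟩
        simp only [hc] at key
        rw [halfTwist_of_pos (hup' 0 t₀.2.1), halfTwist_of_pos (hup' t₀ le_rfl), hstart] at key
        exact ⟨key.symm, by simpa [hφ_id _ hlo hhi] using (hup' t₀ le_rfl).ne'⟩
      | cross t t' w v htr htt hch hsign ih =>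
        intro hhi
        have hlot := hlo.trans htr.le
        obtain ⟨ih, -⟩ := ih (htt.trans hhi)
        have key := hchart w _ (hseg t t') (by
          rintro ⟨s', u⟩ ⟨rfl : s' = s, hu⟩
          simpa [hc, hφ_id u (hlot.trans hu.1) (hu.2.trans hhi)] using hch u hu) (s, t)
            ⟨rfl, le_rfl, htt⟩ (s, t') ⟨rfl, htt, le_rfl⟩
        simp only [hc, hφ_id t hlot (htt.trans hhi), hφ_id t' (hlot.trans htt) hhi, ih] at key
        refine ⟨?_, fun h => by simp [h] at hsign⟩
        rcases mul_neg_iff.1 hsign with ⟨h1, h2⟩ | ⟨h1, h2⟩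
        · rw [halfTwist_of_pos h1, halfTwist_of_neg h2] at key
          rw [key, hτ w]
        · rw [halfTwist_of_neg h1, halfTwist_of_pos h2] at key
          exact key.symm
    obtain ⟨hv, him⟩ := main t v htr hhi
    have hlot := hlo.trans htr.le
    have hfin' : ∀ u, t ≤ u → 0 < (c t).im * (c (φ u)).im := fun u hu =>
      hfin _ ((hφ_id t hlot hhi).symm.trans_le (hφmono hu)) ((hφhi u).trans_lt hhi1)
    have key := hchart 0 _ (hseg t 1) (by
      rintro ⟨s', u⟩ ⟨rfl : s' = s, hu⟩
      exact Or.inl (by simpa [hc] using (right_ne_zero_of_mul (hfin' u hu.1).ne'))) (s, t)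
        ⟨rfl, le_rfl, t.2.2⟩ (s, 1) ⟨rfl, t.2.2, le_rfl⟩
    simp only [hc, hφ_id t hlot hhi] at key
    rcases pos_and_pos_or_neg_and_neg_of_mul_pos (hfin' 1 t.2.2) with ⟨h1, h2⟩ | ⟨h1, h2⟩
    · rw [halfTwist_of_pos h1, halfTwist_of_pos h2] at key
      rw [← key, hv]
    · rw [halfTwist_of_neg h1, halfTwist_of_neg h2] at key
      rw [← (hτ 0).injective key, hv]
  rw [← track 0 a hga t₀ t v hεt₀ hεt hta hea, ← track 1 b hgb t₀' t' v' hεt₀' hεt' htb heb, hend]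

end Tracking

section Words

/-- Reduced words in three letters, the latest letter first, whose first letter is `2`. -/
def IsTurnWord (l : List (Fin 3)) : Prop :=
  l.IsChain (· ≠ ·) ∧ ∀ c ∈ l.getLast?, c = 2

/-- Cancel or prepend the letter `w`; the letters `0` and `1` fix the empty word. -/
def toggleLetter (w : Fin 3) : List (Fin 3) → List (Fin 3)
  | [] => if w = 2 then [2] else []
  | c :: l => if c = w then l else w :: c :: l

lemma IsTurnWord.tail {c : Fin 3} {l : List (Fin 3)} (h : IsTurnWord (c :: l)) :
    IsTurnWord l := by
  refine ⟨h.1.tail, fun x hx => h.2 x ?_⟩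
  cases l with
  | nil => simp at hx
  | cons d l => simpa using hx

lemma IsTurnWord.cons {w c : Fin 3} {l : List (Fin 3)} (h : IsTurnWord (c :: l)) (hw : w ≠ c) :
    IsTurnWord (w :: c :: l) :=
  ⟨List.isChain_cons_cons.2 ⟨hw, h.1⟩, fun x hx => h.2 x (by simpa using hx)⟩

lemma isTurnWord_two : IsTurnWord [2] := by simp [IsTurnWord]

lemma IsTurnWord.toggleLetter {l : List (Fin 3)} (h : IsTurnWord l) (w : Fin 3) :
    IsTurnWord (toggleLetter w l) := by
  cases l with
  | nil =>
    by_cases hw : w = 2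
    · simpa [_root_.toggleLetter, hw] using isTurnWord_two
    · simpa [_root_.toggleLetter, hw] using h
  | cons c l =>
    by_cases hw : c = w
    · simpa [_root_.toggleLetter, hw] using h.tail
    · simpa [_root_.toggleLetter, hw] using h.cons (Ne.symm hw)

lemma toggleLetter_toggleLetter {l : List (Fin 3)} (h : IsTurnWord l) (w : Fin 3) :
    toggleLetter w (toggleLetter w l) = l := by
  match l, h with
  | [], _ => by_cases hw : w = 2 <;> simp [toggleLetter, hw]
  | [c], h =>
    have hc : c = 2 := h.2 c (by simp)
    subst hc
    by_cases hw : 2 = w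
    · simp [toggleLetter, ← hw]
    · simp [toggleLetter, hw]
  | c :: d :: l, h =>
    have hcd : c ≠ d := (List.isChain_cons_cons.1 h.1).1
    by_cases hw : c = w
    · subst hw
      simp [toggleLetter, hcd.symm]
    · simp [toggleLetter, hw]

lemma toggleLetter_cons {w : Fin 3} {l : List (Fin 3)} (h : IsTurnWord (w :: l)) :
    toggleLetter w l = w :: l := by
  cases l with
  | nil =>
    have hw : w = 2 := h.2 w (by simp)
    simp [toggleLetter, hw]
  | cons c l =>
    simp [toggleLetter, (List.isChain_cons_cons.1 h.1).1.symm]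

/-- The reduced words, as a type. -/
abbrev TurnWord := {l : List (Fin 3) // IsTurnWord l}

/-- The action of a letter on reduced words. -/
def turn (w : Fin 3) (v : TurnWord) : TurnWord := ⟨toggleLetter w v.1, v.2.toggleLetter w⟩

lemma turn_involutive (w : Fin 3) : Function.Involutive (turn w) := fun v =>
  Subtype.ext (toggleLetter_toggleLetter v.2 w)

/-- The part of a reduced word up to its latest letter `0`. -/
def turnCore (v : TurnWord) : List (Fin 3) := v.1.dropWhile (fun c => decide (c ≠ 0))

lemma turnCore_turn {w : Fin 3} (hw : w ≠ 0) (v : TurnWord) :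
    turnCore (turn w v) = turnCore v := by
  obtain ⟨l, hl⟩ := v
  cases l with
  | nil => by_cases h : w = 2 <;> simp [turnCore, turn, toggleLetter, h]
  | cons c l =>
    by_cases h : c = w
    · subst h
      simp [turnCore, turn, toggleLetter, hw]
    · simp [turnCore, turn, toggleLetter, h, hw]

lemma turnCore_eq_self {v : TurnWord} (hv : v.1.head? = some 0) : turnCore v = v.1 := by
  obtain ⟨l, hl⟩ := v
  cases l with
  | nil => simp at hv
  | cons c l =>
    simp at hv
    simp [turnCore, hv]

/-- A reduced word encoding a list of bits. -/
def bitWord : List Bool → List (Fin 3)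
  | [] => [2]
  | b :: bs => ((bitWord bs).headD 0 + cond b 1 2) :: bitWord bs

lemma length_bitWord (bs : List Bool) : (bitWord bs).length = bs.length + 1 := by
  induction bs with
  | nil => rfl
  | cons b bs ih => simp [bitWord, ih]

lemma isTurnWord_bitWord (bs : List Bool) : IsTurnWord (bitWord bs) := by
  induction bs with
  | nil => exact isTurnWord_two
  | cons b bs ih =>
    rw [bitWord]
    cases h : bitWord bs with
    | nil => simpa [h] using length_bitWord bs
    | cons c l =>
      rw [h] at ih
      refine ih.cons ?_
      cases b <;> simp

lemma bitWord_injective : Function.Injective bitWord := by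
  intro bs
  induction bs with
  | nil =>
    intro bs' h
    have := congrArg List.length h
    simp [length_bitWord] at this
    exact this.symm
  | cons b bs ih =>
    intro bs' h
    cases bs' with
    | nil => simpa [length_bitWord] using congrArg List.length h
    | cons b' bs' =>
      rw [bitWord, bitWord, List.cons.injEq] at h
      obtain rfl := ih h.2
      cases b <;> cases b' <;> simp at h ⊢

/-- Prepend the letter `0` unless it is already there. -/
def closeWord (l : List (Fin 3)) : List (Fin 3) := if l.head? = some 0 then l else 0 :: l

lemma head?_closeWord (l : List (Fin 3)) : (closeWord l).head? = some 0 := by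
  unfold closeWord
  split_ifs with h
  · exact h
  · rfl

lemma closeWord_injective_of_length {l l' : List (Fin 3)} (hl : l.length = l'.length)
    (h : closeWord l = closeWord l') : l = l' := by
  unfold closeWord at h
  split_ifs at h
  · exact h
  · simpa [hl] using congrArg List.length h
  · simpa [hl] using congrArg List.length h
  · simpa using h

/-- There are at least `2 ^ j` reduced words of length at most `j + 2` ending with `0`. -/
theorem exists_turnWords {j K : ℕ} (hK : K ≤ 2 ^ j) :
    ∃ w : Fin K → TurnWord, Function.Injective w ∧
      ∀ k, (w k).1.head? = some 0 ∧ (w k).1.length ≤ j + 2 := by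
  obtain ⟨f⟩ : Nonempty (Fin K ↪ List.Vector Bool j) :=
    Function.Embedding.nonempty_of_card_le (by simpa using hK)
  have hlen : ∀ k, (bitWord (f k).1).length = j + 1 := fun k => by
    rw [length_bitWord, (f k).2]
  refine ⟨fun k => ⟨closeWord (bitWord (f k).1), ?_⟩, fun k k' h => ?_, fun k => ⟨?_, ?_⟩⟩
  · unfold closeWord
    split_ifs with h
    · exact isTurnWord_bitWord _
    · have := isTurnWord_bitWord (f k).1
      cases h' : bitWord (f k).1 with
      | nil => simpa [h'] using hlen k
      | cons c l =>
        rw [h'] at h this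
        exact this.cons (by simpa [eq_comm] using h)
  · refine f.injective (Subtype.ext (bitWord_injective
      (closeWord_injective_of_length ?_ (Subtype.ext_iff.1 h))))
    rw [hlen, hlen]
  · exact head?_closeWord _
  · dsimp only
    unfold closeWord
    split_ifs <;> simp [hlen]

end Words

section GenericPosition

/-- The determinant of two vectors in the plane. -/
def planeDet (u v : ℂ) : ℝ := u.re * v.im - u.im * v.re

lemma isOpen_planeDet_ne_zero (p q : ℂ) : IsOpen {z : ℂ | planeDet (z - p) q ≠ 0} := by
  refine isOpen_ne_fun ?_ continuous_const
  unfold planeDet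
  fun_prop

lemma dense_planeDet_ne_zero (p : ℂ) {q : ℂ} (hq : q ≠ 0) :
    Dense {z : ℂ | planeDet (z - p) q ≠ 0} := by
  let L : ℂ →ₗ[ℝ] ℝ := q.im • Complex.reLm - q.re • Complex.imLm
  have hL : ∀ z, L z = planeDet z q := fun z => by simp [L, planeDet]; ring
  have hsurj : Function.Surjective L := by
    refine LinearMap.surjective fun h => hq ?_
    have h1 := LinearMap.congr_fun h 1
    have h2 := LinearMap.congr_fun h Complex.I
    simp [L] at h1 h2
    exact Complex.ext h2 h1
  have h := (dense_compl_singleton (L p)).preimage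
    (LinearMap.isOpenMap_of_finiteDimensional L hsurj)
  convert h using 1
  ext z
  simp only [Set.mem_ofPred_eq, Set.mem_preimage, Set.mem_compl_iff, Set.mem_singleton_iff, hL]
  rw [not_iff_not, ← sub_eq_zero (a := planeDet z q)]
  simp [planeDet]
  ring_nf

/-- Distinct pairs among the first `N` points of `P` span nonparallel lines. -/
def IsGeneric (P : ℕ → ℂ) (N : ℕ) : Prop :=
  ∀ a b c d, a < N → b < N → c < N → d < N → a ≠ b → c ≠ d → ¬ (a = c ∧ b = d) →
    ¬ (a = d ∧ b = c) → planeDet (P a - P b) (P c - P d) ≠ 0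

lemma IsGeneric.extend {P : ℕ → ℂ} {N : ℕ} (hP : IsGeneric P N) {z : ℂ}
    (hz : ∀ b c d, b < N → c < N → d < N → c ≠ d → planeDet (z - P b) (P c - P d) ≠ 0) :
    IsGeneric (Function.update P N z) (N + 1) := by
  have key : ∀ a, a < N + 1 → a = N ∨ a < N := by omega
  have hup : ∀ a, a < N → Function.update P N z a = P a := fun a ha =>
    Function.update_of_ne ha.ne _ _
  intro a b c d ha hb hc hd hab hcd h1 h2
  rcases key a ha with rfl | ha
  · have hb := (key b hb).resolve_left (Ne.symm hab)
    rw [Function.update_self, hup b hb]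
    rcases key c hc with rfl | hc
    · have hd := (key d hd).resolve_left (Ne.symm hcd)
      rw [Function.update_self, hup d hd]
      have := hz b b d hb hb hd (by simpa using h1)
      contrapose this
      simp [planeDet] at this ⊢
      linarith
    · rw [hup c hc]
      rcases key d hd with rfl | hd
      · rw [Function.update_self]
        have := hz b b c hb hb hc (by simpa using h2)
        contrapose this
        simp [planeDet] at this ⊢
        linarith
      · rw [hup d hd]
        exact hz b c d hb hc hd hcd
  · rw [hup a ha]
    rcases key b hb with rfl | hb
    · rw [Function.update_self]
      rcases key c hc with rfl | hc
      · have hd := (key d hd).resolve_left (Ne.symm hcd)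
        rw [Function.update_self, hup d hd]
        have := hz a a d ha ha hd (by simpa using h2)
        contrapose this
        simp [planeDet] at this ⊢
        linarith
      · rw [hup c hc]
        rcases key d hd with rfl | hd
        · rw [Function.update_self]
          have := hz a a c ha ha hc (by simpa using h1)
          contrapose this
          simp [planeDet] at this ⊢
          linarith
        · rw [hup d hd]
          have := hz a c d ha hc hd hcd
          contrapose this
          simp [planeDet] at this ⊢
          linarith
    · rw [hup b hb]
      rcases key c hc with rfl | hc
      · have hd := (key d hd).resolve_left (Ne.symm hcd)
        rw [Function.update_self, hup d hd]
        have := hz d a b hd ha hb hab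
        contrapose this
        simp [planeDet] at this ⊢
        linarith
      · rw [hup c hc]
        rcases key d hd with rfl | hd
        · rw [Function.update_self]
          have := hz c a b hc ha hb hab
          contrapose this
          simp [planeDet] at this ⊢
          linarith
        · rw [hup d hd]
          exact hP a b c d ha hb hc hd hab hcd h1 h2

/-- Points can be chosen successively in nonempty open sets so as to be in general position. -/
theorem exists_isGeneric {C : ℕ → ℂ → Set ℂ} (hopen : ∀ n z, IsOpen (C n z))
    (hne : ∀ n z, (C n z).Nonempty) (N : ℕ) :
    ∃ P : ℕ → ℂ, P 0 = 0 ∧ P 1 = 1 ∧ (∀ n, 1 ≤ n → n + 1 < N → P (n + 1) ∈ C n (P n)) ∧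
      IsGeneric P N := by
  suffices h : ∃ P : ℕ → ℂ, P 0 = 0 ∧ P 1 = 1 ∧
      (∀ n, 1 ≤ n → n + 1 < N + 2 → P (n + 1) ∈ C n (P n)) ∧
      (∀ a b, a < N + 2 → b < N + 2 → a ≠ b → P a ≠ P b) ∧ IsGeneric P (N + 2) by
    obtain ⟨P, h0, h1, hC, -, hg⟩ := h
    exact ⟨P, h0, h1, fun n h h' => hC n h (by omega),
      fun a b c d ha hb hc hd => hg a b c d (by omega) (by omega) (by omega) (by omega)⟩
  induction N with
  | zero =>
    refine ⟨fun n => n, by simp, by simp, by omega, fun a b _ _ hab => by simpa using hab, ?_⟩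
    intro a b c d
    omega
  | succ N ih =>
    obtain ⟨P, h0, h1, hC, hinj, hg⟩ := ih
    let T := {x : Fin (N + 2) × Fin (N + 2) × Fin (N + 2) // x.2.1 ≠ x.2.2}
    have hd : Dense (⋂ x : T, {z : ℂ | planeDet (z - P x.1.1) (P x.1.2.1 - P x.1.2.2) ≠ 0}) :=
      dense_iInter_of_isOpen (fun x => isOpen_planeDet_ne_zero _ _) fun x =>
        dense_planeDet_ne_zero _ (sub_ne_zero.2 (hinj _ _ x.1.2.1.2 x.1.2.2.2
          fun h => x.2 (Fin.ext h)))
    obtain ⟨z, hzC, hz⟩ := hd.inter_open_nonempty _ (hopen (N + 1) (P (N + 1))) (hne _ _)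
    have hz : ∀ b c d, b < N + 2 → c < N + 2 → d < N + 2 → c ≠ d →
        planeDet (z - P b) (P c - P d) ≠ 0 := fun b c d hb hc hd hcd =>
      Set.mem_iInter.1 hz ⟨(⟨b, hb⟩, ⟨c, hc⟩, ⟨d, hd⟩), fun h => hcd (congrArg Fin.val h)⟩
    have hzP : ∀ b, b < N + 2 → z ≠ P b := by
      rintro b hb rfl
      exact hz b 0 1 hb (by omega) (by omega) (by omega) (by simp [planeDet])
    have hup : ∀ a, a < N + 2 → Function.update P (N + 2) z a = P a := fun a ha =>
      Function.update_of_ne ha.ne _ _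
    refine ⟨Function.update P (N + 2) z, by simp [h0], by simp [h1], ?_, ?_, hg.extend hz⟩
    · intro n hn hnN
      rw [hup n (by omega)]
      rcases eq_or_ne n (N + 1) with rfl | h
      · rwa [Function.update_self]
      · rw [hup _ (by omega)]
        exact hC n hn (by omega)
    · intro a b ha hb hab
      rcases eq_or_ne a (N + 2) with rfl | ha'
      · rw [Function.update_self, hup b (by omega)]
        exact hzP b (by omega)
      · rw [hup a (by omega)]
        rcases eq_or_ne b (N + 2) with rfl | hb'
        · rw [Function.update_self]
          exact (hzP a (by omega)).symm
        · rw [hup b (by omega)]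
          exact hinj a b (by omega) (by omega) hab

/-- The real part of the intersection of the line through `z` and `z'` with the real axis. -/
noncomputable def realCrossing (z z' : ℂ) : ℝ :=
  (z.re * z'.im - z'.re * z.im) / (z'.im - z.im)

/-- The points to which a segment from `z` leads across the component `w` of `ℝ \ {0, 1}`. -/
def crossingTargets (w : Fin 3) (z : ℂ) : Set ℂ :=
  {z' | z.im * z'.im < 0 ∧ realCrossing z z' ∈ realGap w}

lemma isOpen_crossingTargets (w : Fin 3) (z : ℂ) : IsOpen (crossingTargets w z) := by
  have h : IsOpen {z' : ℂ | z.im * z'.im < 0} := by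
    refine isOpen_lt ?_ continuous_const
    fun_prop
  refine ContinuousOn.isOpen_inter_preimage ?_ h (isOpen_realGap w)
  unfold realCrossing
  refine ContinuousOn.div (by fun_prop) (by fun_prop) fun z' hz' h0 => ?_
  have : z'.im = z.im := by linarith
  replace hz' : z.im * z'.im < 0 := hz'
  rw [this] at hz'
  nlinarith [mul_self_nonneg z.im]

lemma crossingTargets_nonempty (w : Fin 3) {z : ℂ} (hz : z.im ≠ 0) :
    (crossingTargets w z).Nonempty := by
  have hz2 : 0 < z.im * z.im := mul_self_pos.2 hz
  refine ⟨⟨2 * ((w : ℕ) - 1 / 2) - z.re, -z.im⟩, ?_, ?_⟩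
  · simp only
    linarith
  · have : realCrossing z ⟨2 * ((w : ℕ) - 1 / 2) - z.re, -z.im⟩ = (w : ℕ) - 1 / 2 := by
      simp only [realCrossing]
      rw [div_eq_iff (by intro h; apply hz; linarith)]
      ring
    rw [this]
    fin_cases w <;> simp [realGap] <;> norm_num

lemma segment_subset_slitChart {w : Fin 3} {z z' : ℂ} (h : z' ∈ crossingTargets w z) {x : ℝ} :
    z + (x : ℂ) * (z' - z) ∈ slitChart w := by
  obtain ⟨h1, h2⟩ := h
  by_cases him : (z + (x : ℂ) * (z' - z)).im = 0
  · right
    convert h2 using 1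
    have hne : z'.im - z.im ≠ 0 := by
      intro h0
      have : z'.im = z.im := by linarith
      rw [this] at h1
      nlinarith [mul_self_nonneg z.im]
    simp at him
    rw [realCrossing, eq_div_iff hne]
    simp
    linear_combination (z'.re - z.re) * him
  · exact Or.inl him

end GenericPosition

section Polylines

/-- The polygonal line with `s` edges and vertices `Q 0, Q 1, …, Q s`, parametrized by `[0, s]`. -/
noncomputable def polyline (Q : ℕ → ℂ) (s : ℕ) (x : ℝ) : ℂ :=
  Q 0 + ∑ i ∈ Finset.range s, ((max 0 (min 1 (x - i)) : ℝ) : ℂ) * (Q (i + 1) - Q i)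

lemma continuous_polyline (Q : ℕ → ℂ) (s : ℕ) : Continuous (polyline Q s) := by
  unfold polyline
  fun_prop

lemma polyline_eq (Q : ℕ → ℂ) {s i : ℕ} (hi : i < s) {x : ℝ} (h1 : i ≤ x) (h2 : x ≤ i + 1) :
    polyline Q s x = Q i + ((x - i : ℝ) : ℂ) * (Q (i + 1) - Q i) := by
  have hsub : ∑ k ∈ Finset.range (i + 1),
        ((max 0 (min 1 (x - k)) : ℝ) : ℂ) * (Q (k + 1) - Q k) =
      ∑ k ∈ Finset.range s, ((max 0 (min 1 (x - k)) : ℝ) : ℂ) * (Q (k + 1) - Q k) := by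
    refine Finset.sum_subset (Finset.range_mono hi) fun k _ hk => ?_
    have hk : (i : ℝ) + 1 ≤ k := by exact_mod_cast not_lt.1 (fun h => hk (Finset.mem_range.2 h))
    rw [max_eq_left ((min_le_right _ _).trans (by linarith))]
    simp
  have hfull : ∑ k ∈ Finset.range i, ((max 0 (min 1 (x - k)) : ℝ) : ℂ) * (Q (k + 1) - Q k) =
      ∑ k ∈ Finset.range i, (Q (k + 1) - Q k) := by
    refine Finset.sum_congr rfl fun k hk => ?_
    have hk : (k : ℝ) + 1 ≤ i := by exact_mod_cast Finset.mem_range.1 hk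
    rw [min_eq_left (by linarith), max_eq_right zero_le_one]
    simp
  rw [polyline, ← hsub, Finset.sum_range_succ, hfull, Finset.sum_range_sub,
    min_eq_right (by linarith), max_eq_right (by linarith)]
  ring

lemma polyline_natCast (Q : ℕ → ℂ) {s i : ℕ} (hi : i ≤ s) : polyline Q s i = Q i := by
  rcases hi.lt_or_eq with hi | rfl
  · simpa using polyline_eq Q hi le_rfl (by linarith)
  · cases i with
    | zero => simp [polyline]
    | succ i =>
      have := polyline_eq Q i.lt_succ_self (x := (i + 1 : ℕ)) (by simp) (by simp)
      simpa using this

/-- The polygonal line with vertices `Q 0, Q 1, …, Q s`, parametrized by `[0, 1]`. -/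
noncomputable def unitPolyline (Q : ℕ → ℂ) (s : ℕ) (t : I) : ℂ := polyline Q s (s * t)

lemma continuous_unitPolyline (Q : ℕ → ℂ) (s : ℕ) : Continuous (unitPolyline Q s) :=
  (continuous_polyline Q s).comp (by fun_prop)

lemma unitPolyline_zero (Q : ℕ → ℂ) (s : ℕ) : unitPolyline Q s 0 = Q 0 := by
  simpa [unitPolyline] using polyline_natCast Q (Nat.zero_le s)

lemma unitPolyline_one (Q : ℕ → ℂ) (s : ℕ) : unitPolyline Q s 1 = Q s := by
  simpa [unitPolyline] using polyline_natCast Q (le_refl s)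

/-- The time at which the polygonal line with `s` edges reaches its `i`-th vertex. -/
noncomputable def vertexTime (s i : ℕ) : I := Set.projIcc 0 1 zero_le_one ((i : ℝ) / s)

lemma coe_vertexTime {s i : ℕ} (hi : i ≤ s) : (vertexTime s i : ℝ) = i / s := by
  have h : (i : ℝ) / s ∈ Set.Icc (0 : ℝ) 1 :=
    ⟨by positivity, div_le_one_of_le₀ (by exact_mod_cast hi) (by positivity)⟩
  rw [vertexTime, Set.projIcc_of_mem _ h]

lemma mul_vertexTime {s i : ℕ} (hs : 0 < s) (hi : i ≤ s) : (s : ℝ) * vertexTime s i = i := by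
  rw [coe_vertexTime hi]
  field_simp

lemma vertexTime_le_iff {s i : ℕ} (hs : 0 < s) (hi : i ≤ s) {u : I} :
    vertexTime s i ≤ u ↔ (i : ℝ) ≤ s * u := by
  have hs' : (0 : ℝ) < s := by exact_mod_cast hs
  rw [← mul_vertexTime hs hi, mul_le_mul_iff_right₀ hs']
  rfl

lemma le_vertexTime_iff {s i : ℕ} (hs : 0 < s) (hi : i ≤ s) {u : I} :
    u ≤ vertexTime s i ↔ (s * u : ℝ) ≤ i := by
  have hs' : (0 : ℝ) < s := by exact_mod_cast hs
  rw [← mul_vertexTime hs hi, mul_le_mul_iff_right₀ hs']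
  rfl

lemma unitPolyline_vertexTime (Q : ℕ → ℂ) {s i : ℕ} (hs : 0 < s) (hi : i ≤ s) :
    unitPolyline Q s (vertexTime s i) = Q i := by
  rw [unitPolyline, mul_vertexTime hs hi, polyline_natCast Q hi]

/-- The vertices of a polygonal line from `0` to `1` that spells out the word `v`. -/
structure Spells (Q : ℕ → ℂ) (v : List (Fin 3)) : Prop where
  zero : Q 0 = 0
  one : 0 < (Q 1).im
  cross : ∀ i (hi : i < v.length),
    Q (i + 2) ∈ crossingTargets (v[v.length - 1 - i]'(by omega)) (Q (i + 1))
  last : Q (v.length + 2) = 1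

variable {Q : ℕ → ℂ} {v : List (Fin 3)}

lemma Spells.im_ne_zero (h : Spells Q v) {i : ℕ} (hi : i ≤ v.length) : (Q (i + 1)).im ≠ 0 := by
  cases i with
  | zero => exact h.one.ne'
  | succ i =>
    have := (h.cross i hi).1
    intro h0
    simp [h0] at this

/-- The empty word. -/
def emptyTurnWord : TurnWord := ⟨[], by simp [IsTurnWord]⟩

lemma IsTurnWord.drop {l : List (Fin 3)} (h : IsTurnWord l) (k : ℕ) : IsTurnWord (l.drop k) := by
  induction k generalizing l with
  | zero => exact h
  | succ k ih =>
    cases l with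
    | nil => exact h
    | cons c l => exact ih h.tail

lemma Spells.traces {v : TurnWord} (h : Spells Q v.1) :
    Traces turn (unitPolyline Q (v.1.length + 2)) (vertexTime (v.1.length + 2) 1) emptyTurnWord
      (vertexTime (v.1.length + 2) (v.1.length + 1)) v := by
  set s := v.1.length + 2 with hs
  have hs0 : 0 < s := by omega
  suffices hi : ∀ i ≤ v.1.length, Traces turn (unitPolyline Q s) (vertexTime s 1) emptyTurnWord
      (vertexTime s (i + 1)) ⟨v.1.drop (v.1.length - i), v.2.drop _⟩ by
    simpa using hi _ le_rfl
  intro i hi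
  induction i with
  | zero =>
    have : (⟨v.1.drop (v.1.length - 0), v.2.drop _⟩ : TurnWord) = emptyTurnWord :=
      Subtype.ext (by simp [emptyTurnWord])
    rw [this]
    refine Traces.start fun u hu0 hu => ?_
    rw [le_vertexTime_iff hs0 (by omega)] at hu
    have hu0 : (0 : ℝ) < u := hu0
    have hsu : (0 : ℝ) < s * u := by positivity
    rw [unitPolyline, polyline_eq Q hs0 (by simpa using hsu.le) (by simpa using hu), h.zero]
    simp only [Nat.cast_zero, sub_zero, zero_add, Complex.im_ofReal_mul]
    exact mul_pos hsu h.one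
  | succ i ih =>
    have hc := h.cross i hi
    set w := v.1[v.1.length - 1 - i]'(by omega) with hw
    have hdrop : v.1.drop (v.1.length - (i + 1)) = w :: v.1.drop (v.1.length - i) := by
      have := List.drop_eq_getElem_cons (l := v.1) (i := v.1.length - 1 - i) (by omega)
      rw [show v.1.length - (i + 1) = v.1.length - 1 - i by omega, this,
        show v.1.length - 1 - i + 1 = v.1.length - i by omega]
    have hstate : (⟨v.1.drop (v.1.length - (i + 1)), v.2.drop _⟩ : TurnWord) =
        turn w ⟨v.1.drop (v.1.length - i), v.2.drop _⟩ := by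
      refine Subtype.ext ?_
      have h' := v.2.drop (v.1.length - (i + 1))
      simp only [turn]
      rw [hdrop] at h' ⊢
      exact (toggleLetter_cons h').symm
    rw [hstate]
    refine Traces.cross _ _ w _ (ih (by omega)) ?_ (fun u hu => ?_) ?_
    · rw [vertexTime_le_iff hs0 (by omega), mul_vertexTime hs0 (by omega)]
      push_cast
      linarith
    · have h1 := (vertexTime_le_iff hs0 (by omega)).1 hu.1
      have h2 := (le_vertexTime_iff hs0 (by omega)).1 hu.2
      rw [unitPolyline, polyline_eq Q (i := i + 1) (by omega) h1 (by exact_mod_cast h2)]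
      exact segment_subset_slitChart hc
    · rw [unitPolyline_vertexTime Q hs0 (by omega), unitPolyline_vertexTime Q hs0 (by omega)]
      exact hc.1

lemma Spells.im_mul_im_pos (h : Spells Q v) {u : I}
    (hu : vertexTime (v.length + 2) (v.length + 1) ≤ u) (hu1 : u < 1) :
    0 < (unitPolyline Q (v.length + 2) (vertexTime (v.length + 2) (v.length + 1))).im *
      (unitPolyline Q (v.length + 2) u).im := by
  have hs0 : 0 < v.length + 2 := by omega
  have h1 := (vertexTime_le_iff hs0 (by omega)).1 hu
  have hu1 : (u : ℝ) < 1 := hu1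
  have h2 : ((v.length + 2 : ℕ) : ℝ) * u < (v.length + 1 : ℕ) + 1 := by
    push_cast
    nlinarith
  rw [unitPolyline_vertexTime Q hs0 (by omega), unitPolyline,
    polyline_eq Q (i := v.length + 1) (by omega) h1 h2.le, h.last]
  simp only [Complex.add_im, Complex.im_ofReal_mul, Complex.sub_im, Complex.one_im]
  have := mul_self_pos.2 (h.im_ne_zero le_rfl)
  nlinarith

lemma Spells.notMem (h : Spells Q v) {u : I} (hu0 : u ≠ 0) (hu1 : u ≠ 1) :
    unitPolyline Q (v.length + 2) u ∉ ({0, 1} : Set ℂ) := by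
  have hs0 : 0 < v.length + 2 := by omega
  have hu0 : (0 : ℝ) < u := unitInterval.pos_iff_ne_zero.2 hu0
  have hu1' : u < 1 := unitInterval.lt_one_iff_ne_one.2 hu1
  have hu1 : (u : ℝ) < 1 := hu1'
  have hs : (0 : ℝ) < (v.length + 2 : ℕ) := by exact_mod_cast hs0
  set s := v.length + 2 with hsdef
  have hx0 : (0 : ℝ) < s * u := by positivity
  have hxs : (s * u : ℝ) < s := by nlinarith
  suffices hne : (unitPolyline Q s u).im ≠ 0 ∨ ∃ w, unitPolyline Q s u ∈ slitChart w by
    rcases hne with hne | ⟨w, hw⟩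
    · rintro (h | h) <;> simp [Set.mem_singleton_iff.1 h] at hne
    · rintro (h | h) <;> rw [Set.mem_singleton_iff.1 h] at hw <;> fin_cases w <;>
        norm_num [slitChart, realGap] at hw
  set i := ⌊(s * u : ℝ)⌋₊ with hi
  have h1 : (i : ℝ) ≤ s * u := Nat.floor_le hx0.le
  have h2 : (s * u : ℝ) < i + 1 := Nat.lt_floor_add_one _
  have his : i < s := by exact_mod_cast h1.trans_lt hxs
  rcases Nat.eq_zero_or_pos i with h0 | h0
  · left
    rw [h0] at h1 h2
    rw [unitPolyline, polyline_eq Q hs0 h1 h2.le, h.zero]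
    simp only [Nat.cast_zero, sub_zero, zero_add, Complex.im_ofReal_mul]
    exact (mul_pos hx0 h.one).ne'
  · obtain ⟨k, hk⟩ : ∃ k, i = k + 1 := ⟨i - 1, by omega⟩
    by_cases hl : k = v.length
    · left
      have h3 : vertexTime s (v.length + 1) ≤ u := by
        rw [vertexTime_le_iff hs0 (by omega), ← hl, ← hk]
        exact h1
      intro h4
      have := h.im_mul_im_pos h3 hu1'
      rw [h4] at this
      simp at this
    · right
      rw [hk] at h1 h2
      rw [unitPolyline, polyline_eq Q (i := k + 1) (by omega) h1 h2.le]
      exact ⟨_, segment_subset_slitChart (h.cross k (by omega))⟩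

/-- The homotopy class of a polygonal line with given word ending in `0` determines the word. -/
theorem Spells.eq_of_homotopicIn {Q Q' : ℕ → ℂ} {v v' : TurnWord} (h : Spells Q v.1)
    (h' : Spells Q' v'.1) (hv : v.1.head? = some 0) (hv' : v'.1.head? = some 0)
    (hom : HomotopicIn {0, 1} (unitPolyline Q (v.1.length + 2))
      (unitPolyline Q' (v'.1.length + 2))) : v = v' := by
  have key : ∀ v : TurnWord, 0 < vertexTime (v.1.length + 2) 1 ∧
      vertexTime (v.1.length + 2) (v.1.length + 1) < 1 := fun v => by
    constructor
    · rw [← not_le, vertexTime_le_iff (by omega) (by omega)]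
      simp
    · rw [← not_le, le_vertexTime_iff (by omega) (by omega)]
      simp
  refine Subtype.ext ?_
  rw [← turnCore_eq_self hv, ← turnCore_eq_self hv']
  refine HomotopicIn.eq_of_traces turn_involutive (v₀ := emptyTurnWord) (Subtype.ext ?_)
    (Subtype.ext ?_) (turnCore_turn (by decide)) (turnCore_turn (by decide)) hom ?_ ?_
    (fun t ht0 ht1 => h.notMem ht0 ht1) (fun t ht0 ht1 => h'.notMem ht0 ht1)
    (key v).1 (key v).2 (key v').1 (key v').2 h.traces h'.traces
    (fun u hu hu1 => h.im_mul_im_pos hu hu1) (fun u hu hu1 => h'.im_mul_im_pos hu hu1)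
  · rfl
  · rfl
  · rw [unitPolyline_zero, h.zero]
  · rw [unitPolyline_one, h.last]

end Polylines

section BaseFamily

lemma exists_generic_vertices (letter : ℕ → ℕ → Fin 3) (K S : ℕ) :
    ∃ P : ℕ → ℂ, P 0 = 0 ∧ P 1 = 1 ∧ IsGeneric P (K * S + 2) ∧ ∀ k < K, ∀ i, i + 1 < S →
      (i = 0 → 0 < (P (k * S + i + 2)).im) ∧
      (0 < i → P (k * S + i + 2) ∈ crossingTargets (letter k i) (P (k * S + i + 1))) := by
  classical
  let C : ℕ → ℂ → Set ℂ := fun n z =>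
    if n % S ≤ 1 ∨ z.im = 0 then {z | 0 < z.im} else crossingTargets (letter (n / S) (n % S - 1)) z
  obtain ⟨P, h0, h1, hC, hg⟩ := exists_isGeneric (C := C) (fun n z => by
      by_cases h : n % S ≤ 1 ∨ z.im = 0
      · simpa only [C, if_pos h] using isOpen_lt continuous_const Complex.continuous_im
      · simpa only [C, if_neg h] using isOpen_crossingTargets _ _) (fun n z => by
      by_cases h : n % S ≤ 1 ∨ z.im = 0
      · simp only [C, if_pos h]
        exact ⟨Complex.I, by simp⟩
      · simp only [C, if_neg h]
        exact crossingTargets_nonempty _ (fun h' => h (Or.inr h'))) (K * S + 2)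
  refine ⟨P, h0, h1, hg, fun k hk i => ?_⟩
  have hkS : k * S + S ≤ K * S := by
    rw [← Nat.succ_mul]
    exact Nat.mul_le_mul_right _ hk
  have hmod : ∀ i < S, (k * S + i) % S = i := fun i hi => by
    rw [Nat.mul_comm, Nat.mul_add_mod, Nat.mod_eq_of_lt hi]
  have hdiv : ∀ i < S, (k * S + i) / S = k := fun i hi => by
    rw [Nat.mul_comm, Nat.mul_add_div (by omega), Nat.div_eq_of_lt hi, add_zero]
  induction i with
  | zero =>
    intro hi
    refine ⟨fun _ => ?_, fun h => (lt_irrefl _ h).elim⟩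
    have h := hC (k * S + 1) (by omega) (by omega)
    simp only [C, hmod 1 hi, le_refl, true_or, if_true] at h
    exact h
  | succ i ih =>
    intro hi
    refine ⟨fun h => (Nat.succ_ne_zero _ h).elim, fun _ => ?_⟩
    have him : (P (k * S + i + 2)).im ≠ 0 := by
      obtain ⟨h1, h2⟩ := ih (by omega)
      rcases Nat.eq_zero_or_pos i with h | h
      · exact (h1 h).ne'
      · intro h'
        have := (h2 h).1
        simp [h'] at this
    have h := hC (k * S + (i + 2)) (by omega) (by omega)
    have hneg : ¬ ((k * S + (i + 2)) % S ≤ 1 ∨ (P (k * S + (i + 2))).im = 0) := by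
      rw [hmod _ hi]
      rintro (h | h)
      · omega
      · exact him h
    simp only [C, if_neg hneg, hmod _ hi, hdiv _ hi] at h
    exact h

/-- The position in a common sequence `0, 1, …` of the `i`-th vertex of the `k`-th of several
polygonal lines from `0` to `1`, with `l + 2` edges each and `S` positions reserved for it. -/
def vertexIndex (S l k i : ℕ) : ℕ := if i = 0 then 0 else if i = l + 2 then 1 else k * S + i + 1

lemma vertexIndex_cases (S l k i : ℕ) :
    (i = 0 ∧ vertexIndex S l k i = 0) ∨ (i = l + 2 ∧ vertexIndex S l k i = 1) ∨
      (0 < i ∧ i ≠ l + 2 ∧ vertexIndex S l k i = k * S + i + 1) := by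
  unfold vertexIndex
  split_ifs <;> omega

lemma mul_add_injective {S k k' i i' : ℕ} (hi : i < S) (hi' : i' < S)
    (h : k * S + i = k' * S + i') : k = k' ∧ i = i' := by
  have h1 := congrArg (· % S) h
  have h2 := congrArg (· / S) h
  simp only [Nat.mul_comm _ S] at h1 h2
  simp only [Nat.mul_add_mod, Nat.mod_eq_of_lt hi, Nat.mod_eq_of_lt hi'] at h1
  simp only [Nat.mul_add_div (by omega : S > 0), Nat.div_eq_of_lt hi, Nat.div_eq_of_lt hi',
    add_zero] at h2
  exact ⟨h2, h1⟩

lemma vertexIndex_lt {S K l k i : ℕ} (hk : k < K) (hl : l + 1 < S) (hi : i ≤ l + 2) :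
    vertexIndex S l k i < K * S + 2 := by
  have hkS : k * S + S ≤ K * S := by
    rw [← Nat.succ_mul]
    exact Nat.mul_le_mul_right _ hk
  rcases vertexIndex_cases S l k i with h | h | h <;> omega

lemma vertexIndex_ne {S l k i : ℕ} : vertexIndex S l k i ≠ vertexIndex S l k (i + 1) := by
  rcases vertexIndex_cases S l k i with h | h | h <;>
    rcases vertexIndex_cases S l k (i + 1) with h' | h' | h' <;> omega

lemma vertexIndex_pair {S l l' k k' i i' : ℕ} (hl : l + 1 < S) (hl' : l' + 1 < S)
    (hi : i < l + 2) (hi' : i' < l' + 2)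
    (h1 : vertexIndex S l k i = vertexIndex S l' k' i')
    (h2 : vertexIndex S l k (i + 1) = vertexIndex S l' k' (i' + 1)) : k = k' ∧ i = i' := by
  rcases vertexIndex_cases S l k i with h | h | h <;>
    rcases vertexIndex_cases S l' k' i' with h' | h' | h' <;> try omega
  · rcases vertexIndex_cases S l k (i + 1) with g | g | g <;>
      rcases vertexIndex_cases S l' k' (i' + 1) with g' | g' | g' <;> try omega
    have := mul_add_injective (S := S) (k := k) (k' := k') (i := i + 1) (i' := i' + 1)
      (by omega) (by omega) (by omega)
    omega
  · exact mul_add_injective (S := S) (by omega) (by omega) (by omega)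

lemma vertexIndex_pair_swap {S l l' k k' i i' : ℕ} (hi : i < l + 2) (hi' : i' < l' + 2)
    (h1 : vertexIndex S l k i = vertexIndex S l' k' (i' + 1))
    (h2 : vertexIndex S l k (i + 1) = vertexIndex S l' k' i') : False := by
  rcases vertexIndex_cases S l k i with h | h | h <;>
    rcases vertexIndex_cases S l' k' (i' + 1) with h' | h' | h' <;> try omega
  rcases vertexIndex_cases S l k (i + 1) with g | g | g <;>
    rcases vertexIndex_cases S l' k' i' with g' | g' | g' <;> try omega

lemma eq_of_nonparallel {p p' u u' : ℂ} (h : planeDet u u' ≠ 0) {x y x' y' : ℝ}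
    (h1 : p + x * u = p' + x' * u') (h2 : p + y * u = p' + y' * u') : x = y ∧ x' = y' := by
  have h3 : ((x - y : ℝ) : ℂ) * u = ((x' - y' : ℝ) : ℂ) * u' := by
    push_cast
    linear_combination h1 - h2
  have hre := congrArg Complex.re h3
  have him := congrArg Complex.im h3
  simp only [Complex.re_ofReal_mul, Complex.im_ofReal_mul] at hre him
  have e1 : (x - y) * planeDet u u' = 0 := by
    unfold planeDet
    linear_combination hre * u'.im - him * u'.re
  have e2 : (x' - y') * planeDet u u' = 0 := by
    unfold planeDet
    linear_combination hre * u.im - him * u.re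
  exact ⟨sub_eq_zero.1 ((mul_eq_zero.1 e1).resolve_right h),
    sub_eq_zero.1 ((mul_eq_zero.1 e2).resolve_right h)⟩

/-- A family of pairwise non-homotopic curves from `0` to `1` in the plane punctured at `0` and
`1`, cut into at most `j + 4` pieces each, such that two pieces meet at most once. -/
theorem exists_nonhomotopic_family {K j : ℕ} (hK : K ≤ 2 ^ j) :
    ∃ (γ : Fin K → I → ℂ) (piece : Fin K → I → Fin (j + 4)),
      (∀ k, Continuous (γ k) ∧ γ k 0 = 0 ∧ γ k 1 = 1 ∧
        ∀ t, t ≠ 0 → t ≠ 1 → γ k t ∉ ({0, 1} : Set ℂ)) ∧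
      (∀ k k', HomotopicIn {0, 1} (γ k) (γ k') → k = k') ∧
      ∀ k k' t t' u u', (k, t) ≠ (k', t') → t ≠ 1 → t' ≠ 1 → u ≠ 1 → u' ≠ 1 →
        γ k t = γ k' t' → γ k u = γ k' u' → piece k t = piece k u → piece k' t' = piece k' u' →
        t = u ∧ t' = u' := by
  obtain ⟨w, hw, hwv⟩ := exists_turnWords hK
  obtain ⟨P, hP0, hP1, hg, hP⟩ := exists_generic_vertices (fun k i => if h : k < K then
    (w ⟨k, h⟩).1.getD ((w ⟨k, h⟩).1.length - i) 0 else 0) K (j + 4)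
  set l : Fin K → ℕ := fun k => (w k).1.length with hl
  have hlj : ∀ k, l k + 1 < j + 4 := fun k => by have := (hwv k).2; simp only [hl]; omega
  set V : Fin K → ℕ → ℂ := fun k i => P (vertexIndex (j + 4) (l k) k i) with hV
  have hspell : ∀ k, Spells (V k) (w k).1 := fun k => by
    have hlk := hlj k
    have hlen : (w k).1.length = l k := rfl
    refine ⟨by simp [hV, vertexIndex, hP0], ?_, fun i hi => ?_, by simp [hV, vertexIndex, hl, hP1]⟩
    · simpa [hV, vertexIndex] using (hP k k.2 0 (by omega)).1 rfl
    · have hi' : i < l k := hi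
      have h := (hP k k.2 (i + 1) (by omega)).2 (by omega)
      simp only [k.2, dif_pos, Fin.eta] at h
      rw [List.getD_eq_getElem _ _ (by omega)] at h
      have e1 : V k (i + 2) = P (k * (j + 4) + (i + 1) + 2) := by
        simp only [hV, vertexIndex]
        rw [if_neg (by omega), if_neg (by omega)]
        rfl
      have e2 : V k (i + 1) = P (k * (j + 4) + (i + 1) + 1) := by
        simp only [hV, vertexIndex]
        rw [if_neg (by omega), if_neg (by omega)]
      have e3 : (w k).1.length - (i + 1) = (w k).1.length - 1 - i := by omega
      rw [e1, e2]
      simpa only [e3] using h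
  have hfloor : ∀ (k : Fin K) (t : I), t ≠ 1 → ⌊((l k + 2 : ℕ) * t : ℝ)⌋₊ < l k + 2 :=
    fun k t ht => by
      have ht : (t : ℝ) < 1 := unitInterval.lt_one_iff_ne_one.2 ht
      have h0 : (0 : ℝ) < (l k + 2 : ℕ) := by positivity
      rw [Nat.floor_lt (mul_nonneg h0.le t.2.1)]
      nlinarith
  have hpoly : ∀ (k : Fin K) (t : I), t ≠ 1 → unitPolyline (V k) (l k + 2) t =
      V k ⌊((l k + 2 : ℕ) * t : ℝ)⌋₊ +
        (((l k + 2 : ℕ) * t - ⌊((l k + 2 : ℕ) * t : ℝ)⌋₊ : ℝ) : ℂ) *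
        (V k (⌊((l k + 2 : ℕ) * t : ℝ)⌋₊ + 1) - V k ⌊((l k + 2 : ℕ) * t : ℝ)⌋₊) :=
    fun k t ht => polyline_eq _ (hfloor k t ht)
      (Nat.floor_le (mul_nonneg (Nat.cast_nonneg _) t.2.1)) (Nat.lt_floor_add_one _).le
  have hcancel : ∀ (k : Fin K) (t u : I), ((l k + 2 : ℕ) * t : ℝ) = (l k + 2 : ℕ) * u → t = u :=
    fun k t u h => Subtype.ext (mul_left_cancel₀ (by positivity) h)
  have hdet : ∀ (k k' : Fin K) (i i' : ℕ), i < l k + 2 → i' < l k' + 2 → ¬ (k = k' ∧ i = i') →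
      planeDet (V k (i + 1) - V k i) (V k' (i' + 1) - V k' i') ≠ 0 := by
    intro k k' i i' hi hi' hne
    refine hg _ _ _ _ (vertexIndex_lt k.2 (hlj k) (by omega))
      (vertexIndex_lt k.2 (hlj k) (by omega)) (vertexIndex_lt k'.2 (hlj k') (by omega))
      (vertexIndex_lt k'.2 (hlj k') (by omega)) vertexIndex_ne.symm vertexIndex_ne.symm ?_ ?_
    · rintro ⟨h1, h2⟩
      obtain ⟨h3, h4⟩ := vertexIndex_pair (hlj k) (hlj k') hi hi' h2 h1
      exact hne ⟨Fin.ext h3, h4⟩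
    · rintro ⟨h1, h2⟩
      exact vertexIndex_pair_swap hi hi' h2 h1
  have hne : ∀ (k : Fin K) (i : ℕ), i < l k + 2 → V k (i + 1) - V k i ≠ 0 := by
    intro k i hi h0
    have : ∃ i' < l k + 2, i ≠ i' := by
      by_cases h : i = 0
      · exact ⟨1, by omega, by omega⟩
      · exact ⟨0, by omega, h⟩
    obtain ⟨i', hi', hii⟩ := this
    apply hdet k k i i' hi hi' (fun h => hii h.2)
    rw [h0]
    simp [planeDet]
  refine ⟨fun k => unitPolyline (V k) (l k + 2),
    fun k t => Fin.ofNat (j + 4) ⌊((l k + 2 : ℕ) * t : ℝ)⌋₊, fun k => ⟨continuous_unitPolyline _ _,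
      (unitPolyline_zero _ _).trans (hspell k).zero, (unitPolyline_one _ _).trans (hspell k).last,
      fun t h0 h1 => (hspell k).notMem h0 h1⟩, fun k k' h => hw ?_, ?_⟩
  · exact (hspell k).eq_of_homotopicIn (hspell k') (hwv k).1 (hwv k').1 h
  intro k k' t t' u u' hktne ht ht' hu hu' e1 e2 p1 p2
  have hfin : ∀ (k : Fin K) (t u : I), t ≠ 1 → u ≠ 1 →
      Fin.ofNat (j + 4) ⌊((l k + 2 : ℕ) * t : ℝ)⌋₊ =
        Fin.ofNat (j + 4) ⌊((l k + 2 : ℕ) * u : ℝ)⌋₊ →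
      ⌊((l k + 2 : ℕ) * t : ℝ)⌋₊ = ⌊((l k + 2 : ℕ) * u : ℝ)⌋₊ := by
    intro k t u ht hu h
    have h1 := hfloor k t ht
    have h2 := hfloor k u hu
    have h3 := hlj k
    have h4 := congrArg Fin.val h
    simp only [Fin.val_ofNat] at h4
    rwa [Nat.mod_eq_of_lt (by omega), Nat.mod_eq_of_lt (by omega)] at h4
  replace p1 := hfin k t u ht hu p1
  replace p2 := hfin k' t' u' ht' hu' p2
  have ei := hfloor k t ht
  have ei' := hfloor k' t' ht'
  dsimp only at e1 e2
  rw [hpoly k t ht, hpoly k' t' ht'] at e1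
  rw [hpoly k u hu, hpoly k' u' hu', ← p1, ← p2] at e2
  set i := ⌊((l k + 2 : ℕ) * t : ℝ)⌋₊
  set i' := ⌊((l k' + 2 : ℕ) * t' : ℝ)⌋₊
  by_cases hsame : k = k' ∧ i = i'
  · obtain ⟨rfl, hi⟩ := hsame
    rw [← hi] at e1
    have := mul_right_cancel₀ (hne k i ei) (add_left_cancel e1)
    refine (hktne ?_).elim
    rw [hcancel k t t']
    have := Complex.ofReal_injective this
    linarith
  · obtain ⟨h1, h2⟩ := eq_of_nonparallel (hdet k k' i i' ei ei' hsame) e1 e2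
    exact ⟨hcancel k t u (by linarith), hcancel k' t' u' (by linarith)⟩

end BaseFamily

section Assembly

lemma HomotopicIn.apply_zero {V : Set ℂ} {a b : I → ℂ} (h : HomotopicIn V a b) : b 0 = a 0 := by
  obtain ⟨g, -, -, h1, h2, -, -⟩ := h
  rw [← h1, h2]

lemma HomotopicIn.apply_one {V : Set ℂ} {a b : I → ℂ} (h : HomotopicIn V a b) : b 1 = a 1 := by
  obtain ⟨g, -, -, h1, -, h2, -⟩ := h
  rw [← h1, h2]

lemma HomotopicIn.of_add_const {V W : Set ℂ} {a b : I → ℂ} {c : ℂ}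
    (h : HomotopicIn V (fun t => a t + c) (fun t => b t + c)) (hW : ∀ z ∈ W, z + c ∈ V) :
    HomotopicIn W a b := by
  obtain ⟨g, hg, h1, h2, h3, h4, h5⟩ := h
  exact ⟨fun p => g p - c, hg.sub continuous_const, fun t => by simp [h1], fun t => by simp [h2],
    fun s => by simp [h3], fun s => by simp [h4], fun s t hs0 hs1 ht0 ht1 hmem =>
      h5 s t hs0 hs1 ht0 ht1 (by simpa using hW _ hmem)⟩

lemma eq_of_add_mul_eq {L : ℝ} {z z' : ℂ} {a b : ℕ} (hL : ‖z‖ + ‖z'‖ < L)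
    (h : z + L * a = z' + L * b) : a = b := by
  have hre := congrArg Complex.re h
  simp at hre
  have h1 := abs_le.1 (Complex.abs_re_le_norm z)
  have h2 := abs_le.1 (Complex.abs_re_le_norm z')
  have hL0 : 0 < L := (by positivity : 0 ≤ ‖z‖ + ‖z'‖).trans_lt hL
  rcases lt_trichotomy a b with hab | hab | hab
  · have : (a : ℝ) + 1 ≤ b := by exact_mod_cast hab
    nlinarith
  · exact hab
  · have : (b : ℝ) + 1 ≤ a := by exact_mod_cast hab
    nlinarith

/-- A drawing consisting of `N` translated copies of a family of `K` curves. -/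
theorem exists_drawing_of_le {n m N K j : ℕ} (hn : 2 * N ≤ n) (hm : m ≤ N * K) (hK : K ≤ 2 ^ j) :
    ∃ D : PlaneDrawing n m, D.NonHomotopic ∧
      D.crossingNumber ≤ ((N * (K * (j + 4)) ^ 2 : ℕ) : ℝ≥0∞) / 2 := by
  obtain ⟨γ, piece, hγ, hhom, hcross⟩ := exists_nonhomotopic_family hK
  obtain ⟨ι⟩ : Nonempty (Fin m ↪ Fin N × Fin K) :=
    Function.Embedding.nonempty_of_card_le (by simpa using hm)
  obtain ⟨R, hR⟩ : ∃ R : ℝ, ∀ k t, ‖γ k t‖ ≤ R := by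
    choose r hr using fun k =>
      isCompact_univ.exists_bound_of_continuousOn (hγ k).1.continuousOn
    obtain ⟨R, hR⟩ := (Set.finite_range r).bddAbove
    exact ⟨R, fun k t => (hr k t trivial).trans (hR ⟨k, rfl⟩)⟩
  set L : ℝ := 2 * |R| + 4 with hL
  have hRL : R + 1 < L := by linarith [le_abs_self R, abs_nonneg R]
  have hRR : R + R < L := by linarith [le_abs_self R, abs_nonneg R]
  have h2L : 2 < L := by linarith [abs_nonneg R]
  let pos : ℕ → ℂ := fun i => ((i % 2 : ℕ) : ℂ) + L * ((i / 2 : ℕ) : ℂ)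
  have hmod : ∀ i : ℕ, ‖((i % 2 : ℕ) : ℂ)‖ ≤ 1 := fun i => by
    rw [Complex.norm_natCast]
    exact_mod_cast Nat.lt_succ_iff.1 (Nat.mod_lt i two_pos)
  have hpos : Function.Injective pos := fun i i' h => by
    have h1 : i / 2 = i' / 2 := eq_of_add_mul_eq (by linarith [hmod i, hmod i']) h
    have h2 : i % 2 = i' % 2 := by
      simp only [pos, h1] at h
      exact_mod_cast add_right_cancel h
    omega
  have hzero : ∀ g : Fin N, (0 : ℂ) + L * (g : ℕ) ∈ pos '' Set.Iio n := fun g =>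
    ⟨2 * g, by have := g.2; simp only [Set.mem_Iio]; omega, by simp [pos]⟩
  have hone : ∀ g : Fin N, (1 : ℂ) + L * (g : ℕ) ∈ pos '' Set.Iio n := fun g =>
    ⟨2 * g + 1, by have := g.2; simp only [Set.mem_Iio]; omega, by
      simp only [pos]
      rw [show (2 * (g : ℕ) + 1) % 2 = 1 by omega, show (2 * (g : ℕ) + 1) / 2 = g by omega]
      simp⟩
  let D : PlaneDrawing n m :=
    { V := pos '' Set.Iio n
      finV := (Set.finite_Iio n).image pos
      cardV := by rw [Set.ncard_image_of_injective _ hpos]; simp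
      f := fun e t => γ (ι e).2 t + L * ((ι e).1 : ℕ)
      cont := fun e => (hγ _).1.add continuous_const
      source_mem := fun e => by rw [(hγ _).2.1]; exact hzero _
      target_mem := fun e => by rw [(hγ _).2.2.1]; exact hone _
      interior_not_mem := by
        rintro e t h0 h1 ⟨i, -, hi⟩
        have hi' : i / 2 = (ι e).1 :=
          eq_of_add_mul_eq (by linarith [hmod i, hR (ι e).2 t]) hi
        simp only [pos, hi'] at hi
        apply (hγ (ι e).2).2.2.2 t h0 h1
        rw [← add_right_cancel hi]
        rcases Nat.mod_two_eq_zero_or_one i with h | h <;> simp [h] }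
  have hD0 : ∀ e, D.f e 0 = 0 + L * ((ι e).1 : ℕ) := fun e => by
    simp only [D]
    rw [(hγ _).2.1]
  have hD1 : ∀ e, D.f e 1 = 1 + L * ((ι e).1 : ℕ) := fun e => by
    simp only [D]
    rw [(hγ _).2.2.1]
  have hD01 : ∀ e e', D.f e 1 ≠ D.f e' 0 := fun e e' h => by
    rw [hD0, hD1] at h
    have h' := eq_of_add_mul_eq (by simp; linarith) h
    rw [h'] at h
    exact one_ne_zero (add_right_cancel h)
  refine ⟨D, ⟨fun e e' hee hom => ?_, fun e hom => ?_⟩, ?_⟩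
  · rcases hom with hom | hom
    · have h0 := hom.apply_zero
      rw [hD0, hD0] at h0
      have hg : (ι e).1 = (ι e').1 := Fin.ext (eq_of_add_mul_eq (by simp; linarith) h0).symm
      refine hee (ι.injective (Prod.ext hg (hhom _ _ (HomotopicIn.of_add_const (V := D.V)
        (c := L * ((ι e).1 : ℕ)) ?_ ?_))))
      · simp only [D] at hom
        rwa [← hg] at hom
      · rintro z (rfl | hz)
        · exact hzero _
        · rw [Set.mem_singleton_iff.1 hz]
          exact hone _
    · refine hD01 e e' ?_
      simpa using hom.apply_zero.symm
  · rcases hom with hom | hom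
    · exact hD01 e e hom.apply_one.symm
    · refine hD01 e e ?_
      simpa using hom.apply_zero.symm
  · unfold PlaneDrawing.crossingNumber
    refine ENNReal.div_le_div_right ?_ 2
    set X := {p : (Fin m × I) × (Fin m × I) |
      p.1 ≠ p.2 ∧ p.1.2 ≠ 0 ∧ p.1.2 ≠ 1 ∧ p.2.2 ≠ 0 ∧ p.2.2 ≠ 1 ∧
      D.f p.1.1 p.1.2 = D.f p.2.1 p.2.2} with hX
    have hgroup : ∀ e e' t t', D.f e t = D.f e' t' →
        (ι e).1 = (ι e').1 ∧ γ (ι e).2 t = γ (ι e').2 t' := fun e e' t t' h => by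
      have hg : (ι e).1 = (ι e').1 :=
        Fin.ext (eq_of_add_mul_eq (by linarith [hR (ι e).2 t, hR (ι e').2 t']) h)
      simp only [D, hg] at h
      exact ⟨hg, add_right_cancel h⟩
    let code : (Fin m × I) × (Fin m × I) →
        Fin N × (Fin K × Fin (j + 4)) × (Fin K × Fin (j + 4)) := fun p =>
      ((ι p.1.1).1, ((ι p.1.1).2, piece (ι p.1.1).2 p.1.2),
        ((ι p.2.1).2, piece (ι p.2.1).2 p.2.2))
    have hinj : Set.InjOn code X := by
      rintro ⟨⟨e, t⟩, ⟨e', t'⟩⟩ ⟨hne, -, ht, -, ht', heq⟩ ⟨⟨d, u⟩, ⟨d', u'⟩⟩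
        ⟨-, -, hu, -, hu', heq'⟩ hcode
      simp only [code, Prod.mk.injEq] at hcode
      obtain ⟨c1, ⟨c2, c3⟩, c4, c5⟩ := hcode
      dsimp only at hne ht ht' heq hu hu' heq'
      obtain ⟨g1, g2⟩ := hgroup _ _ _ _ heq
      obtain ⟨g3, g4⟩ := hgroup _ _ _ _ heq'
      obtain rfl : e = d := ι.injective (Prod.ext c1 c2)
      obtain rfl : e' = d' := ι.injective (Prod.ext (g1.symm.trans g3) c4)
      obtain ⟨rfl, rfl⟩ := hcross (ι e).2 (ι e').2 t t' u u' (fun h => hne (by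
        rw [Prod.mk.injEq] at h ⊢
        exact ⟨ι.injective (Prod.ext g1 h.1), h.2⟩)) ht ht' hu hu' g2 g4 c3 c5
      rfl
    have hcard : X.encard ≤ (N * (K * (j + 4)) ^ 2 : ℕ) := by
      rw [← hinj.encard_image]
      refine (Set.encard_le_encard (Set.subset_univ _)).trans (le_of_eq ?_)
      rw [Set.encard_univ, ENat.card_eq_coe_fintype_card]
      simp [sq]
    exact_mod_cast ENat.toENNReal_le.2 hcard

end Assembly

section Estimates

lemma group_bounds {n m N K : ℕ} (hN : N = n / 2) (hK : K = (m + N - 1) / N) (hn : 2 ≤ n)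
    (hm : 4 * n < m) : m ≤ N * K ∧ 0 < K ∧ K * n ≤ 3 * m ∧
      5 * (N * n * K ^ 2) ≤ 16 * m ^ 2 := by
  have hN0 : 0 < N := by omega
  have h1 : N * K ≤ m + N - 1 := hK ▸ Nat.mul_div_le _ _
  have h2 : m + N - 1 < N * K + N := by
    rw [hK]
    exact Nat.lt_mul_div_succ _ hN0
  have h3 : m ≤ N * K := by omega
  have hK0 : 0 < K := by
    rcases Nat.eq_zero_or_pos K with h | h
    · subst h
      omega
    · exact h
  refine ⟨h3, hK0, ?_⟩
  by_cases hn3 : n = 3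
  · obtain rfl : N = 1 := by omega
    obtain rfl : K = m := by omega
    subst hn3
    exact ⟨by omega, by nlinarith⟩
  · have h5 : 2 * n ≤ 5 * N := by omega
    have h6 : 8 * (N * K) ≤ 9 * m := by omega
    have h7 : 5 * (N * K) ≤ 6 * m := by omega
    constructor
    · have := Nat.mul_le_mul_left K h5
      nlinarith
    · have e1 := Nat.mul_le_mul_left (5 * (N * K ^ 2)) h5
      have e2 := Nat.mul_le_mul h6 h6
      nlinarith

lemma logb_two_three_le : Real.logb 2 3 ≤ 8 / 5 := by
  have h : Real.logb 2 ((3 : ℝ) ^ 5) ≤ Real.logb 2 ((2 : ℝ) ^ 8) :=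
    Real.logb_le_logb_of_le one_lt_two (by norm_num) (by norm_num)
  rw [Real.logb_pow, Real.logb_pow, Real.logb_self_eq_one one_lt_two] at h
  push_cast at h
  linarith

lemma crossings_le {n m N K : ℕ} (hn : 2 ≤ n) (hm : 4 * n < m) (hK0 : 0 < K)
    (hKn : K * n ≤ 3 * m) (hNK : 5 * (N * n * K ^ 2) ≤ 16 * m ^ 2) :
    ((N * (K * (Nat.clog 2 K + 4)) ^ 2 : ℕ) : ℝ) / 2 ≤
      30 * ((m : ℝ) ^ 2 / n) * (Real.logb 2 ((m : ℝ) / n)) ^ 2 := by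
  have hn0 : (0 : ℝ) < n := by positivity
  have hm' : (4 : ℝ) * n < m := by exact_mod_cast hm
  have hm0 : (0 : ℝ) < m := by linarith
  set L := Real.logb 2 ((m : ℝ) / n) with hL
  have hL2 : 2 ≤ L := by
    rw [hL, Real.le_logb_iff_rpow_le one_lt_two (by positivity), le_div_iff₀ hn0]
    norm_num
    linarith
  have hlogK : Real.logb 2 K ≤ L + 8 / 5 := by
    have h1 : Real.logb 2 K ≤ Real.logb 2 (3 * ((m : ℝ) / n)) := by
      refine Real.logb_le_logb_of_le one_lt_two (by positivity) ?_
      rw [← mul_div_assoc, le_div_iff₀ hn0]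
      exact_mod_cast hKn
    rw [Real.logb_mul (by norm_num) (by positivity)] at h1
    linarith [logb_two_three_le]
  have hclog : (Nat.clog 2 K : ℝ) ≤ Real.logb 2 K + 1 := by
    have h0 : 0 ≤ Real.logb 2 K := Real.logb_nonneg one_lt_two (by exact_mod_cast hK0)
    have := (Nat.ceil_lt_add_one h0).le
    rwa [← Nat.cast_ofNat (R := ℝ), Real.natCeil_logb_natCast] at this
  have hs : (Nat.clog 2 K : ℝ) + 4 ≤ 43 / 10 * L := by linarith
  have hs2 : ((Nat.clog 2 K : ℝ) + 4) ^ 2 ≤ (43 / 10 * L) ^ 2 := by gcongr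
  have hNK' : 5 * ((N : ℝ) * n * K ^ 2) ≤ 16 * (m : ℝ) ^ 2 := by exact_mod_cast hNK
  have hprod : 5 * ((N : ℝ) * n * K ^ 2) * ((Nat.clog 2 K : ℝ) + 4) ^ 2 ≤
      16 * (m : ℝ) ^ 2 * (43 / 10 * L) ^ 2 := by gcongr
  have hpos : 0 ≤ (m : ℝ) ^ 2 * L ^ 2 := by positivity
  rw [show 30 * ((m : ℝ) ^ 2 / n) * L ^ 2 = 30 * (m : ℝ) ^ 2 * L ^ 2 / n by ring,
    le_div_iff₀ hn0]
  push_cast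
  nlinarith

end Estimates

/-- For all `n ≥ 2` and `m > 4n` there is a non-homotopic drawing in the
plane with `n` vertices and `m` edges whose crossing number is at most
`30 · (m²/n) · (log₂(m/n))²`. -/
theorem crossing_number_upper_bound (n m : ℕ) (hn : 2 ≤ n) (hm : 4 * n < m) :
    ∃ D : PlaneDrawing n m, D.NonHomotopic ∧
      D.crossingNumber ≤
        ENNReal.ofReal (30 * ((m : ℝ) ^ 2 / n) * (Real.logb 2 ((m : ℝ) / n)) ^ 2) := by
  obtain ⟨h1, h2, h3, h4⟩ := group_bounds rfl rfl hn hm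
  obtain ⟨D, hD, hcr⟩ := exists_drawing_of_le (Nat.mul_div_le n 2) h1
    (Nat.le_pow_clog one_lt_two _)
  refine ⟨D, hD, hcr.trans ?_⟩
  refine le_trans (le_of_eq ?_) (ENNReal.ofReal_le_ofReal (crossings_le hn hm h2 h3 h4))
  rw [ENNReal.ofReal_div_of_pos two_pos, ENNReal.ofReal_natCast, ENNReal.ofReal_ofNat]
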